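/- Fix μ ≥ 0 and B > 0, and let Φ be the standard normal CDF with inverse Φ⁻¹ on (0,1). Then the finite-horizon ceiling U*(N,B) = N · Φ(Φ⁻¹(B/N) + μ) grows subpolynomially: for every ε > 0, U*(N,B) / N^ε → 0 as N → ∞. Consequently, for any ball-verifier acceptance rate q > 0, the linear utility q·N eventually strictly exceeds U*(N,B): there exists N₀ such that for all N ≥ N₀, q·N > N · Φ(Φ⁻¹(B/N) + μ). -/

import Mathlib

open Filter Set

/-- The standard normal CDF Φ(x) = ∫_{−∞}^{x} (2π)^{−1/2} e^{−t²/2} dt. -/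
noncomputable def stdNormalCDF (x : ℝ) : ℝ :=
  ∫ t in Set.Iic x, (Real.sqrt (2 * Real.pi))⁻¹ * Real.exp (-(t ^ 2) / 2)

/-- The inverse Φ⁻¹ of the standard normal CDF (meaningful on (0,1)). -/
noncomputable def stdNormalCDFInv : ℝ → ℝ :=
  Function.invFun stdNormalCDF

noncomputable def auxPhi (t : ℝ) : ℝ :=
  (Real.sqrt (2 * Real.pi))⁻¹ * Real.exp (-(t ^ 2) / 2)

lemma auxPhi_eq : auxPhi = ProbabilityTheory.gaussianPDFReal 0 1 := by
  funext t
  simp [auxPhi, ProbabilityTheory.gaussianPDFReal]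

lemma auxPhi_int : MeasureTheory.Integrable auxPhi := by
  rw [auxPhi_eq]; exact ProbabilityTheory.integrable_gaussianPDFReal 0 1

lemma auxPhi_nonneg (t : ℝ) : 0 ≤ auxPhi t := by
  unfold auxPhi; positivity

lemma auxPhi_total : ∫ t, auxPhi t = 1 := by
  rw [auxPhi_eq]; exact ProbabilityTheory.integral_gaussianPDFReal_eq_one 0 one_ne_zero

lemma cdf_def (x : ℝ) : stdNormalCDF x = ∫ t in Set.Iic x, auxPhi t := rfl

lemma cdf_nonneg' (x : ℝ) : 0 ≤ stdNormalCDF x := by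
  rw [cdf_def]
  exact MeasureTheory.integral_nonneg auxPhi_nonneg

lemma cdf_le_one' (x : ℝ) : stdNormalCDF x ≤ 1 := by
  rw [cdf_def, ← auxPhi_total]
  exact MeasureTheory.setIntegral_le_integral auxPhi_int (MeasureTheory.ae_of_all _ auxPhi_nonneg)

lemma cdf_cont : Continuous stdNormalCDF := by
  have h : stdNormalCDF = fun x => stdNormalCDF 0 + ∫ t in (0:ℝ)..x, auxPhi t := by
    funext x
    rw [← intervalIntegral.integral_Iic_sub_Iic auxPhi_int.integrableOn auxPhi_int.integrableOn,
      cdf_def, cdf_def]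
    ring
  rw [h]
  exact continuous_const.add (intervalIntegral.continuous_primitive
    (fun a b => auxPhi_int.intervalIntegrable) 0)

lemma cdf_surj (p : ℝ) (h0 : 0 < p) (h1 : p < 1) : stdNormalCDF (stdNormalCDFInv p) = p := by
  apply Function.invFun_eq
  have hb : Tendsto stdNormalCDF atBot (nhds 0) :=
    MeasureTheory.tendsto_integral_Iic_zero (f := auxPhi) tendsto_id
  have ht : Tendsto stdNormalCDF atTop (nhds 1) := by
    rw [← auxPhi_total]
    exact (MeasureTheory.aecover_Iic tendsto_id).integral_tendsto_of_countably_generated auxPhi_int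
  exact mem_range_of_exists_le_of_exists_ge cdf_cont
    ((hb.eventually (eventually_le_nhds h0)).exists)
    ((ht.eventually (eventually_ge_nhds h1)).exists)

lemma cdf_shift (x c : ℝ) : stdNormalCDF (x + c) = ∫ t in Set.Iic x, auxPhi (t + c) := by
  have := (MeasureTheory.measurePreserving_add_right MeasureTheory.volume c).setIntegral_preimage_emb
    (measurableEmbedding_addRight c) auxPhi (Set.Iic (x + c))
  rw [cdf_def, ← this]
  simp

lemma aux_pt (μ k r t : ℝ) (hr : 0 ≤ r) :
    auxPhi (t + μ) ≤ Real.exp k * auxPhi t +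
      Real.exp (-(r * k)) * Real.exp (((1 + r) * μ) ^ 2 / 2 - (1 + r) * μ * μ / 2) *
        auxPhi (t + (1 + r) * μ) := by
  unfold auxPhi
  have hs : 0 ≤ (Real.sqrt (2 * Real.pi))⁻¹ := by positivity
  have key : Real.exp (-((t + μ) ^ 2) / 2) ≤ Real.exp (k + -(t ^ 2) / 2) +
      Real.exp (-(r * k) + (((1 + r) * μ) ^ 2 / 2 - (1 + r) * μ * μ / 2)
        + -((t + (1 + r) * μ) ^ 2) / 2) := by
    rcases le_total (-(μ * t) - μ ^ 2 / 2) k with h | h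
    · have : Real.exp (-((t + μ) ^ 2) / 2) ≤ Real.exp (k + -(t ^ 2) / 2) :=
        Real.exp_le_exp.2 (by nlinarith)
      have := Real.exp_pos (-(r * k) + (((1 + r) * μ) ^ 2 / 2 - (1 + r) * μ * μ / 2)
        + -((t + (1 + r) * μ) ^ 2) / 2)
      linarith
    · have : Real.exp (-((t + μ) ^ 2) / 2) ≤
        Real.exp (-(r * k) + (((1 + r) * μ) ^ 2 / 2 - (1 + r) * μ * μ / 2)
        + -((t + (1 + r) * μ) ^ 2) / 2) :=
        Real.exp_le_exp.2 (by nlinarith [mul_le_mul_of_nonneg_left h hr])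
      have := Real.exp_pos (k + -(t ^ 2) / 2)
      linarith
  rw [Real.exp_add, Real.exp_add, Real.exp_add] at key
  have := mul_le_mul_of_nonneg_left key hs
  linarith

lemma aux_cdf (μ k r x : ℝ) (hr : 0 ≤ r) :
    stdNormalCDF (x + μ) ≤ Real.exp k * stdNormalCDF x +
      Real.exp (-(r * k)) * Real.exp (((1 + r) * μ) ^ 2 / 2 - (1 + r) * μ * μ / 2) := by
  set A := Real.exp (-(r * k)) * Real.exp (((1 + r) * μ) ^ 2 / 2 - (1 + r) * μ * μ / 2) with hA
  have hA0 : 0 ≤ A := by positivity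
  have h1 : stdNormalCDF (x + μ) ≤ Real.exp k * stdNormalCDF x +
      A * stdNormalCDF (x + (1 + r) * μ) := by
    rw [cdf_shift x μ, cdf_shift x ((1 + r) * μ), cdf_def, ← MeasureTheory.integral_const_mul,
      ← MeasureTheory.integral_const_mul, ← MeasureTheory.integral_add]
    · apply MeasureTheory.integral_mono
      · exact (auxPhi_int.comp_add_right μ).integrableOn
      · exact ((auxPhi_int.const_mul _).add
          ((auxPhi_int.comp_add_right ((1 + r) * μ)).const_mul A)).integrableOn
      · intro t
        exact aux_pt μ k r t hr
    · exact (auxPhi_int.const_mul _).integrableOn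
    · exact ((auxPhi_int.comp_add_right ((1 + r) * μ)).const_mul A).integrableOn
  have := mul_le_mul_of_nonneg_left (cdf_le_one' (x + (1 + r) * μ)) hA0
  linarith

lemma aux_main (μ : ℝ) (B : ℝ) (hB : 0 < B) (ε : ℝ) (hε : 0 < ε) :
      Filter.Tendsto
        (fun N : ℕ =>
          ((N : ℝ) * stdNormalCDF (stdNormalCDFInv (B / N) + μ)) / (N : ℝ) ^ ε)
        Filter.atTop (nhds 0) := by
  set r : ℝ := 2 / ε with hr
  have hr0 : 0 ≤ r := by positivity
  set A := Real.exp (((1 + r) * μ) ^ 2 / 2 - (1 + r) * μ * μ / 2) with hA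
  have hlim : Tendsto (fun N : ℕ => B * (N : ℝ) ^ (-(ε / 2)) + A * (N : ℝ) ^ (-ε))
      atTop (nhds 0) := by
    have h1 := ((tendsto_rpow_neg_atTop (half_pos hε)).comp
      (tendsto_natCast_atTop_atTop (R := ℝ))).const_mul B
    have h2 := ((tendsto_rpow_neg_atTop hε).comp
      (tendsto_natCast_atTop_atTop (R := ℝ))).const_mul A
    simpa using h1.add h2
  refine tendsto_of_tendsto_of_tendsto_of_le_of_le' tendsto_const_nhds hlim ?_ ?_
  · filter_upwards with N
    have := cdf_nonneg' (stdNormalCDFInv (B / N) + μ)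
    positivity
  · filter_upwards [eventually_gt_atTop 0,
      (tendsto_natCast_atTop_atTop (R := ℝ)).eventually (eventually_gt_atTop B)] with N hN hNB
    have hN' : (0 : ℝ) < N := by exact_mod_cast hN
    have h := aux_cdf μ (ε / 2 * Real.log N) r (stdNormalCDFInv (B / N)) hr0
    rw [cdf_surj _ (by positivity) ((div_lt_one hN').2 hNB)] at h
    have e1 : Real.exp (ε / 2 * Real.log N) = (N : ℝ) ^ (ε / 2) := by
      rw [Real.rpow_def_of_pos hN', mul_comm]
    have e2 : Real.exp (-(r * (ε / 2 * Real.log N))) = (N : ℝ)⁻¹ := by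
      have : r * (ε / 2 * Real.log N) = Real.log N := by
        rw [hr]; field_simp
      rw [this, Real.exp_neg, Real.exp_log hN']
    rw [e1, e2, ← hA] at h
    have e3 : (N : ℝ) ^ ε = (N : ℝ) ^ (ε / 2) * (N : ℝ) ^ (ε / 2) := by
      rw [← Real.rpow_add hN']; ring_nf
    have hp : 0 < (N : ℝ) ^ (ε / 2) := Real.rpow_pos_of_pos hN' _
    rw [Real.rpow_neg hN'.le, Real.rpow_neg hN'.le, e3, div_le_iff₀ (by positivity)]
    have h2 := mul_le_mul_of_nonneg_left h hN'.le
    refine h2.trans (le_of_eq ?_)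
    field_simp

/-- The finite-horizon ceiling U*(N,B) = N·Φ(Φ⁻¹(B/N)+μ) grows subpolynomially:
U*(N,B)/N^ε → 0 for every ε > 0; consequently any linear utility q·N with
q > 0 eventually strictly dominates it. -/
theorem stmt_13 (μ : ℝ) (hμ : 0 ≤ μ) (B : ℝ) (hB : 0 < B) :
    (∀ ε : ℝ, 0 < ε →
      Filter.Tendsto
        (fun N : ℕ =>
          ((N : ℝ) * stdNormalCDF (stdNormalCDFInv (B / N) + μ)) / (N : ℝ) ^ ε)
        Filter.atTop (nhds 0)) ∧
    (∀ q : ℝ, 0 < q → ∃ N₀ : ℕ, ∀ N : ℕ, N₀ ≤ N →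
      q * (N : ℝ) > (N : ℝ) * stdNormalCDF (stdNormalCDFInv (B / N) + μ)) := by
  refine ⟨fun ε hε => aux_main μ B hB ε hε, fun q hq => ?_⟩
  have h := (aux_main μ B hB 1 one_pos).eventually (eventually_lt_nhds hq)
  obtain ⟨N₀, h0⟩ := eventually_atTop.1 (h.and (eventually_gt_atTop 0))
  refine ⟨N₀, fun N hN => ?_⟩
  obtain ⟨h1, h2⟩ := h0 N hN
  have hN' : (0 : ℝ) < N := by exact_mod_cast h2
  rw [Real.rpow_one, div_lt_iff₀ hN'] at h1
  exact h1
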